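/- Suppose h : ℝ → ℝ is convex (not necessarily strictly convex or smooth), assumptions 2–6 hold, and additionally the second moments are integrable: ∫_0^1 ∫_ℝ x² dμ_t(x) dt < ∞. Then the process X^opt is optimal: for every process Y in Π, E[h(∫_0^1 Y_t dt)] ≤ E[h(∫_0^1 X^opt_t dt)]. -/

import Mathlib

open MeasureTheory Filter Set

/-- The cumulative distribution function of a measure on `ℝ`. -/
noncomputable def mCdf (μ : Measure ℝ) (x : ℝ) : ℝ := (μ (Set.Iic x)).toReal

/-- The quantile function (generalized inverse cdf) of a measure on `ℝ`:
`F⁻¹(l) = inf {x | F(x) ≥ l}`. -/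
noncomputable def mQuantile (μ : Measure ℝ) (l : ℝ) : ℝ := sInf {x : ℝ | l ≤ mCdf μ x}

/-- The support of a measure on `ℝ`: points all of whose neighbourhoods have
positive measure. -/
def mSupport (μ : Measure ℝ) : Set ℝ := {x : ℝ | ∀ U ∈ nhds x, 0 < μ U}



/-- Lebesgue measure on `(0,1)`. -/
noncomputable abbrev uL : Measure ℝ := (volume : Measure ℝ).restrict (Ioo (0:ℝ) 1)

instance uL_prob : IsProbabilityMeasure uL := ⟨by simp [uL]⟩

/-- quantile function, set to zero outside `(0,1)` -/
noncomputable def qf (ν : Measure ℝ) (l : ℝ) : ℝ :=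
  open Classical in if l ∈ Ioo (0:ℝ) 1 then mQuantile ν l else 0

lemma mQuantile_le_iff (ν : Measure ℝ) [IsProbabilityMeasure ν] {l : ℝ} (hl : l ∈ Ioo (0:ℝ) 1)
    (x : ℝ) : mQuantile ν l ≤ x ↔ l ≤ mCdf ν x := by
  have hF : mCdf ν = fun x => ProbabilityTheory.cdf ν x := by
    funext x
    rw [ProbabilityTheory.cdf_eq_real]; rfl
  unfold mQuantile
  rw [hF]
  have hbdd : BddBelow {x : ℝ | l ≤ ProbabilityTheory.cdf ν x} := by
    have := (ProbabilityTheory.tendsto_cdf_atBot ν).eventually (gt_mem_nhds hl.1)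
    obtain ⟨b, hb⟩ := this.exists
    refine ⟨b, fun y hy => ?_⟩
    by_contra hlt
    have := ProbabilityTheory.monotone_cdf ν (not_le.1 hlt).le
    simp only [mem_ofPred_eq] at hy
    linarith
  have hne : {x : ℝ | l ≤ ProbabilityTheory.cdf ν x}.Nonempty := by
    have := (ProbabilityTheory.tendsto_cdf_atTop ν).eventually (lt_mem_nhds hl.2)
    obtain ⟨b, hb⟩ := this.exists
    exact ⟨b, hb.le⟩
  constructor
  · intro h
    have key : ∀ y, x < y → l ≤ ProbabilityTheory.cdf ν y := by
      intro y hy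
      obtain ⟨z, hz, hzy⟩ := exists_lt_of_csInf_lt hne (lt_of_le_of_lt h hy)
      exact le_trans hz (ProbabilityTheory.monotone_cdf ν hzy.le)
    have hc := ((ProbabilityTheory.cdf ν).right_continuous x).tendsto
    have hc' := hc.mono_left (nhdsWithin_mono x Ioi_subset_Ici_self)
    refine ge_of_tendsto hc' ?_
    filter_upwards [self_mem_nhdsWithin] with y hy using key y hy
  · intro h
    exact csInf_le hbdd h

lemma qf_monotoneOn (ν : Measure ℝ) [IsProbabilityMeasure ν] :
    MonotoneOn (qf ν) (Ioo (0:ℝ) 1) := by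
  intro a ha b hb hab
  simp only [qf, if_pos ha, if_pos hb]
  rw [mQuantile_le_iff ν ha]
  exact hab.trans ((mQuantile_le_iff ν hb _).1 le_rfl)

lemma qf_uncurry_measurable (ν : ℝ → Measure ℝ) [∀ t, IsProbabilityMeasure (ν t)]
    (hF : ∀ x, Measurable fun t => mCdf (ν t) x) :
    Measurable (Function.uncurry fun t l => qf (ν t) l) := by
  refine measurable_of_Iic fun x => ?_
  have : (Function.uncurry fun t l => qf (ν t) l) ⁻¹' Iic x
      = ({p : ℝ × ℝ | p.2 ∈ Ioo (0:ℝ) 1} ∩ {p | p.2 ≤ mCdf (ν p.1) x}) ∪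
        ({p : ℝ × ℝ | p.2 ∈ Ioo (0:ℝ) 1}ᶜ ∩ {p | (0:ℝ) ≤ x}) := by
    ext ⟨t, l⟩
    by_cases hl : l ∈ Ioo (0:ℝ) 1
    · simp only [mem_preimage, Function.uncurry, mem_Iic, qf,
        mem_union, mem_inter_iff, mem_ofPred_eq, mem_compl_iff, hl]
      simp [mQuantile_le_iff (ν t) hl]
    · simp only [mem_preimage, Function.uncurry, mem_Iic, qf,
        mem_union, mem_inter_iff, mem_ofPred_eq, mem_compl_iff, hl]
      simp
  rw [this]
  have h1 : MeasurableSet {p : ℝ × ℝ | p.2 ∈ Ioo (0:ℝ) 1} := measurable_snd measurableSet_Ioo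
  exact (h1.inter (measurableSet_le measurable_snd ((hF x).comp measurable_fst))).union
    (h1.compl.inter (MeasurableSet.const _))

lemma qf_measurable (ν : Measure ℝ) [IsProbabilityMeasure ν] : Measurable (qf ν) :=
  (qf_uncurry_measurable (fun _ => ν) (fun _ => measurable_const)).comp
    (measurable_prodMk_left (x := (0:ℝ)))

lemma qf_map (ν : Measure ℝ) [IsProbabilityMeasure ν] : uL.map (qf ν) = ν := by
  have : IsProbabilityMeasure (uL.map (qf ν)) :=
    Measure.isProbabilityMeasure_map (qf_measurable ν).aemeasurable
  refine Measure.ext_of_Iic _ _ fun x => ?_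
  rw [Measure.map_apply (qf_measurable ν) measurableSet_Iic,
    Measure.restrict_apply (qf_measurable ν measurableSet_Iic)]
  have hF0 : 0 ≤ mCdf ν x := ENNReal.toReal_nonneg
  have hF1 : mCdf ν x ≤ 1 := by
    have : (ν (Iic x)) ≤ 1 := prob_le_one
    simpa [mCdf] using ENNReal.toReal_mono ENNReal.one_ne_top this
  have hs : qf ν ⁻¹' Iic x ∩ Ioo 0 1 = Ioo 0 1 ∩ Iic (mCdf ν x) := by
    ext l
    by_cases hl : l ∈ Ioo (0:ℝ) 1
    · simp only [mem_inter_iff, mem_preimage, mem_Iic, qf, hl,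
        and_true, true_and, if_true, mQuantile_le_iff ν hl]
    · simp only [mem_inter_iff, hl, and_false, false_and]
  have hν : ν (Iic x) = ENNReal.ofReal (mCdf ν x) := by
    rw [mCdf, ENNReal.ofReal_toReal (measure_ne_top _ _)]
  rw [hs, hν]
  apply le_antisymm
  · calc volume (Ioo 0 1 ∩ Iic (mCdf ν x)) ≤ volume (Ioc 0 (mCdf ν x)) :=
        measure_mono (fun l hl => ⟨hl.1.1, hl.2⟩)
      _ = _ := by simp
  · calc ENNReal.ofReal (mCdf ν x) = volume (Ioo 0 (mCdf ν x)) := by simp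
      _ ≤ volume (Ioo 0 1 ∩ Iic (mCdf ν x)) := measure_mono (fun l hl => ⟨⟨hl.1, hl.2.trans_le hF1⟩, hl.2.le⟩)

lemma exists_subgrad {h : ℝ → ℝ} (hconv : ConvexOn ℝ Set.univ h) :
    ∃ g : ℝ → ℝ, Monotone g ∧ ∀ x y, h x + g x * (y - x) ≤ h y := by
  refine ⟨fun x => derivWithin h (Ioi x) x, ?_, ?_⟩
  · have := hconv.monotoneOn_rightDeriv
    rw [interior_univ] at this
    exact monotoneOn_univ.1 this
  · intro x y
    have hi : ∀ z : ℝ, z ∈ interior (Set.univ : Set ℝ) := by simp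
    rcases lt_trichotomy x y with hxy | rfl | hxy
    · have := hconv.rightDeriv_le_slope_of_mem_interior (hi x) (mem_univ y) hxy
      rw [slope_def_field, le_div_iff₀ (by linarith)] at this
      linarith
    · simp
    · have h1 := hconv.slope_le_leftDeriv_of_mem_interior (mem_univ y) (hi x) hxy
      have h2 := hconv.leftDeriv_le_rightDeriv_of_mem_interior (hi x)
      have := h1.trans h2
      rw [slope_def_field, div_le_iff₀ (by linarith)] at this
      linarith

lemma integral_eq_of_law {α β : Type*} [MeasurableSpace α] [MeasurableSpace β]
    {P : Measure α} {L : Measure β} {y : α → ℝ} {q : β → ℝ} (hy : Measurable y) (hq : Measurable q)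
    (hlaw : P.map y = L.map q) {f : ℝ → ℝ} (hf : Measurable f) :
    ∫ ω, f (y ω) ∂P = ∫ l, f (q l) ∂L := by
  rw [← integral_map hy.aemeasurable hf.aestronglyMeasurable, hlaw,
    integral_map hq.aemeasurable hf.aestronglyMeasurable]

lemma integrable_of_law {α β : Type*} [MeasurableSpace α] [MeasurableSpace β]
    {P : Measure α} {L : Measure β} {y : α → ℝ} {q : β → ℝ} (hy : Measurable y) (hq : Measurable q)
    (hlaw : P.map y = L.map q) {f : ℝ → ℝ} (hf : Measurable f)
    (hi : Integrable (fun ω => f (y ω)) P) : Integrable (fun l => f (q l)) L := by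
  have h1 := (integrable_map_measure (f := y) (μ := P) (g := f)
    hf.aestronglyMeasurable hy.aemeasurable).2 hi
  rw [hlaw] at h1
  exact (integrable_map_measure hf.aestronglyMeasurable hq.aemeasurable).1 h1

/-- Upper-set comparison. -/
lemma upset_le {Ω : Type*} [MeasurableSpace Ω] {P : Measure Ω} [IsProbabilityMeasure P]
    {y : Ω → ℝ} {q : ℝ → ℝ} (hy : Measurable y) (hq : Measurable q)
    (hmono : MonotoneOn q (Ioo (0:ℝ) 1)) (hlaw : P.map y = uL.map q)
    (hyi : Integrable y P) (hqi : Integrable q uL)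
    {A : Set Ω} {S : Set ℝ} (hA : MeasurableSet A) (hS : MeasurableSet S)
    (hup : ∀ l ∈ Ioo (0:ℝ) 1, ∀ l' ∈ Ioo (0:ℝ) 1, l ≤ l' → l ∈ S → l' ∈ S)
    (hAS : P A = uL S) :
    ∫ ω in A, y ω ∂P ≤ ∫ l in S, q l ∂uL := by
  have hae : ∀ᵐ l ∂uL, l ∈ Ioo (0:ℝ) 1 := ae_restrict_mem measurableSet_Ioo
  by_cases h1 : ∃ l ∈ Ioo (0:ℝ) 1, l ∈ S
  swap
  · push Not at h1
    have : uL S = 0 := by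
      refine measure_mono_null (t := (Ioo (0:ℝ) 1)ᶜ) (fun l hl hl' => h1 l hl' hl) ?_
      exact hae
    rw [Measure.restrict_eq_zero.2 this, Measure.restrict_eq_zero.2 (hAS.trans this)]
    simp
  by_cases h2 : ∃ l ∈ Ioo (0:ℝ) 1, l ∉ S
  swap
  · push Not at h2
    have hSae : ∀ᵐ l ∂uL, l ∈ S := hae.mono fun l hl => h2 l hl
    have hS1 : uL S = 1 := (prob_compl_eq_zero_iff hS).1 hSae
    have hAae : ∀ᵐ ω ∂P, ω ∈ A := (prob_compl_eq_zero_iff hA).2 (hAS.trans hS1)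
    rw [Measure.restrict_eq_self_of_ae_mem hSae, Measure.restrict_eq_self_of_ae_mem hAae]
    exact (integral_eq_of_law hy hq hlaw (f := fun x => x) measurable_id).le
  obtain ⟨l1, hl1, hl1S⟩ := h1
  obtain ⟨l0, hl0, hl0S⟩ := h2
  have hlt : ∀ l ∈ Ioo (0:ℝ) 1, l ∉ S → ∀ l' ∈ Ioo (0:ℝ) 1, l' ∈ S → q l ≤ q l' := by
    intro l hl hlS l' hl' hl'S
    refine hmono hl hl' ?_
    by_contra hc
    exact hlS (hup l' hl' l hl (not_le.1 hc).le hl'S)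
  obtain ⟨c, hc1, hc2⟩ : ∃ c, (∀ l ∈ Ioo (0:ℝ) 1, l ∈ S → c ≤ q l) ∧
      (∀ l ∈ Ioo (0:ℝ) 1, l ∉ S → q l ≤ c) := by
    refine ⟨sInf (q '' (Ioo (0:ℝ) 1 ∩ S)), fun l hl hlS => ?_, fun l hl hlS => ?_⟩
    · refine csInf_le ⟨q l0, ?_⟩ ⟨l, ⟨hl, hlS⟩, rfl⟩
      rintro _ ⟨l', ⟨h, h'⟩, rfl⟩
      exact hlt l0 hl0 hl0S l' h h'
    · refine le_csInf ⟨_, ⟨l1, ⟨hl1, hl1S⟩, rfl⟩⟩ ?_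
      rintro _ ⟨l', ⟨h, h'⟩, rfl⟩
      exact hlt l hl hlS l' h h'
  have hyc : Integrable (fun ω => max (y ω - c) 0) P :=
    (hyi.sub (integrable_const c)).pos_part
  have hreal : P.real A = uL.real S := by simp only [measureReal_def, hAS]
  have e1 : ∫ ω in A, (y ω - c) ∂P ≤ ∫ ω, max (y ω - c) 0 ∂P := by
    refine (setIntegral_mono (s := A) ((hyi.sub (integrable_const c)).integrableOn)
      hyc.integrableOn (fun ω => le_max_left _ _)).trans ?_
    exact setIntegral_le_integral hyc (Eventually.of_forall fun ω => le_max_right _ _)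
  have e2 : ∫ ω, max (y ω - c) 0 ∂P = ∫ l, max (q l - c) 0 ∂uL :=
    integral_eq_of_law hy hq hlaw (f := fun x => max (x - c) 0) (by fun_prop)
  have e3 : ∫ l, max (q l - c) 0 ∂uL = ∫ l in S, (q l - c) ∂uL := by
    rw [← integral_indicator hS]
    refine integral_congr_ae ?_
    filter_upwards [hae] with l hl
    by_cases hlS : l ∈ S
    · rw [indicator_of_mem hlS, max_eq_left (by linarith [hc1 l hl hlS])]
    · rw [indicator_of_notMem hlS, max_eq_right (by linarith [hc2 l hl hlS])]
  have e4 : ∫ ω in A, (y ω - c) ∂P = ∫ ω in A, y ω ∂P - P.real A * c := by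
    rw [integral_sub hyi.integrableOn (integrable_const c)]; simp
  have e5 : ∫ l in S, (q l - c) ∂uL = ∫ l in S, q l ∂uL - uL.real S * c := by
    rw [integral_sub hqi.integrableOn (integrable_const c), setIntegral_const]; simp
  rw [hreal] at e4
  linarith

/-- Layer-cake. -/
lemma layer {α : Type*} [MeasurableSpace α] {ρ : Measure α} [IsProbabilityMeasure ρ]
    {u v : α → ℝ} {M : ℝ} (hu : Measurable u) (hu0 : ∀ x, 0 ≤ u x) (huM : ∀ x, u x ≤ M)
    (hv : Integrable v ρ) :
    (∫ x, u x * v x ∂ρ = ∫ a in Ioc 0 M, ∫ x in {x | a < u x}, v x ∂ρ) ∧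
    IntegrableOn (fun a => ∫ x in {x | a < u x}, v x ∂ρ) (Ioc 0 M) := by
  classical
  let k : ℝ → α → ℝ := fun a x => {x | a < u x}.indicator v x
  have hset : MeasurableSet {p : ℝ × α | p.1 < u p.2} :=
    measurableSet_lt measurable_fst (hu.comp measurable_snd)
  have hk : Integrable (Function.uncurry k) ((volume.restrict (Ioc 0 M)).prod ρ) := by
    have h1 : Integrable (fun p : ℝ × α => v p.2) ((volume.restrict (Ioc 0 M)).prod ρ) :=
      hv.comp_snd _
    refine (h1.indicator hset).congr (Eventually.of_forall ?_)
    rintro ⟨a, x⟩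
    simp [k, indicator, Function.uncurry]
  have hin : ∀ a, ∫ x, k a x ∂ρ = ∫ x in {x | a < u x}, v x ∂ρ := fun a =>
    integral_indicator (measurableSet_lt measurable_const hu)
  have hin2 : ∀ x, ∫ a in Ioc 0 M, k a x = u x * v x := by
    intro x
    have : (fun a => k a x) = (Iio (u x)).indicator (fun _ => v x) := by
      funext a; simp [k, indicator]
    rw [this, integral_indicator measurableSet_Iio, setIntegral_const,
      measureReal_restrict_apply measurableSet_Iio]
    have hs : Iio (u x) ∩ Ioc 0 M = Ioo 0 (u x) := by
      ext a
      constructor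
      · rintro ⟨h1, h2⟩; exact ⟨h2.1, h1⟩
      · rintro ⟨h1, h2⟩; exact ⟨h2, h1, h2.le.trans (huM x)⟩
    rw [hs]
    simp [hu0 x]
  constructor
  · simp_rw [← hin, ← hin2]
    exact (integral_integral_swap hk).symm
  · simp_rw [← hin]
    exact hk.integral_prod_left

lemma jensen_integrable {Ω : Type*} [MeasurableSpace Ω] {P : Measure Ω} [IsProbabilityMeasure P]
    {τ : Measure ℝ} [IsProbabilityMeasure τ] {h : ℝ → ℝ} (hconv : ConvexOn ℝ Set.univ h)
    {Y : ℝ → Ω → ℝ} (hY : Measurable (Function.uncurry Y))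
    (hYi : Integrable (Function.uncurry Y) (τ.prod P))
    (hhi : Integrable (fun p => h (Function.uncurry Y p)) (τ.prod P)) :
    Integrable (fun ω => h (∫ t, Y t ω ∂τ)) P := by
  obtain ⟨g, hgm, hg⟩ := exists_subgrad hconv
  have hc : Continuous h := continuousOn_univ.1 (hconv.continuousOn isOpen_univ)
  have hZm : StronglyMeasurable (fun ω => ∫ t, Y t ω ∂τ) := hY.stronglyMeasurable.integral_prod_left
  have hZi : Integrable (fun ω => ∫ t, Y t ω ∂τ) P := hYi.integral_prod_right
  have hHi : Integrable (fun ω => ∫ t, h (Y t ω) ∂τ) P := hhi.integral_prod_right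
  have hb : Integrable (fun ω => |∫ t, h (Y t ω) ∂τ| + (|h 0| + |g 0| * |∫ t, Y t ω ∂τ|)) P :=
    hHi.abs.add ((integrable_const _).add (hZi.abs.const_mul _))
  refine hb.mono' (hc.comp_stronglyMeasurable hZm).aestronglyMeasurable ?_
  filter_upwards [hYi.prod_left_ae, hhi.prod_left_ae] with ω h1 h2
  have hJ : h (∫ t, Y t ω ∂τ) ≤ ∫ t, h (Y t ω) ∂τ :=
    hconv.map_integral_le hc.continuousOn isClosed_univ (by simp) h1 h2
  have hl := hg 0 (∫ t, Y t ω ∂τ)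
  have a1 := neg_abs_le (h 0)
  have a2 := neg_abs_le (g 0 * (∫ t, Y t ω ∂τ))
  rw [abs_mul] at a2
  have a3 := le_abs_self (∫ t, h (Y t ω) ∂τ)
  have a4 := abs_nonneg (∫ t, h (Y t ω) ∂τ)
  have a5 : 0 ≤ |g 0| * |∫ t, Y t ω ∂τ| := by positivity
  have a6 := abs_nonneg (h 0)
  rw [sub_zero] at hl
  rw [Real.norm_eq_abs, abs_le]
  constructor <;> linarith

section core
variable {Ω : Type*} [MeasurableSpace Ω] {P : Measure Ω} [IsProbabilityMeasure P]
    {τ : Measure ℝ} [IsProbabilityMeasure τ] {Y : ℝ → Ω → ℝ} {Q : ℝ → ℝ → ℝ}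

lemma upset_le_int (hY : Measurable (Function.uncurry Y)) (hQ : Measurable (Function.uncurry Q))
    (hmono : ∀ t, MonotoneOn (Q t) (Ioo (0:ℝ) 1)) (hlaw : ∀ t, P.map (Y t) = uL.map (Q t))
    (hYi : Integrable (Function.uncurry Y) (τ.prod P))
    (hQi : Integrable (Function.uncurry Q) (τ.prod uL))
    {A : Set Ω} {S : Set ℝ} (hA : MeasurableSet A) (hS : MeasurableSet S)
    (hup : ∀ l ∈ Ioo (0:ℝ) 1, ∀ l' ∈ Ioo (0:ℝ) 1, l ≤ l' → l ∈ S → l' ∈ S)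
    (hAS : P A = uL S) :
    ∫ ω in A, (∫ t, Y t ω ∂τ) ∂P ≤ ∫ l in S, (∫ t, Q t l ∂τ) ∂uL := by
  have hYA : Integrable (Function.uncurry Y) (τ.prod (P.restrict A)) :=
    hYi.mono_measure (Measure.prod_mono le_rfl Measure.restrict_le_self)
  have hQS : Integrable (Function.uncurry Q) (τ.prod (uL.restrict S)) :=
    hQi.mono_measure (Measure.prod_mono le_rfl Measure.restrict_le_self)
  rw [← integral_integral_swap hYA, ← integral_integral_swap hQS]
  refine integral_mono_ae hYA.integral_prod_left hQS.integral_prod_left ?_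
  filter_upwards [hYi.prod_right_ae, hQi.prod_right_ae] with t h1 h2
  exact upset_le (hY.comp measurable_prodMk_left) (hQ.comp measurable_prodMk_left) (hmono t)
    (hlaw t) h1 h2 hA hS hup hAS

lemma mono_prod_le (hY : Measurable (Function.uncurry Y)) (hQ : Measurable (Function.uncurry Q))
    (hmono : ∀ t, MonotoneOn (Q t) (Ioo (0:ℝ) 1)) (hlaw : ∀ t, P.map (Y t) = uL.map (Q t))
    (hYi : Integrable (Function.uncurry Y) (τ.prod P))
    (hQi : Integrable (Function.uncurry Q) (τ.prod uL))
    {Z : Ω → ℝ} {U : ℝ → ℝ} (hZ : Measurable Z) (hU : Measurable U)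
    (hUm : MonotoneOn U (Ioo (0:ℝ) 1)) (hZU : P.map Z = uL.map U)
    {ψ : ℝ → ℝ} {M : ℝ} (hψ : Monotone ψ) (hψ0 : ∀ x, 0 ≤ ψ x) (hψM : ∀ x, ψ x ≤ M) :
    ∫ ω, ψ (Z ω) * (∫ t, Y t ω ∂τ) ∂P ≤ ∫ l, ψ (U l) * (∫ t, Q t l ∂τ) ∂uL := by
  have h1 := layer (ρ := P) (u := fun ω => ψ (Z ω)) (v := fun ω => ∫ t, Y t ω ∂τ) (M := M)
    (hψ.measurable.comp hZ) (fun _ => hψ0 _) (fun _ => hψM _) hYi.integral_prod_right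
  have h2 := layer (ρ := uL) (u := fun ω => ψ (U ω)) (v := fun ω => ∫ t, Q t ω ∂τ) (M := M)
    (hψ.measurable.comp hU) (fun _ => hψ0 _) (fun _ => hψM _) hQi.integral_prod_right
  rw [h1.1, h2.1]
  refine integral_mono h1.2 h2.2 fun a => ?_
  have hm : MeasurableSet {x | a < ψ x} := measurableSet_lt measurable_const hψ.measurable
  refine upset_le_int hY hQ hmono hlaw hYi hQi (hZ hm) (hU hm) ?_ ?_
  · intro l hl l' hl' hll hlS
    exact lt_of_lt_of_le hlS (hψ (hUm hl hl' hll))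
  · have := congrArg (fun m => m {x | a < ψ x}) hZU
    simp only [Measure.map_apply hZ hm, Measure.map_apply hU hm] at this
    exact this

theorem core {h : ℝ → ℝ} (hconv : ConvexOn ℝ Set.univ h)
    (hY : Measurable (Function.uncurry Y)) (hQ : Measurable (Function.uncurry Q))
    (hmono : ∀ t, MonotoneOn (Q t) (Ioo (0:ℝ) 1)) (hlaw : ∀ t, P.map (Y t) = uL.map (Q t))
    (hYi : Integrable (Function.uncurry Y) (τ.prod P))
    (hQi : Integrable (Function.uncurry Q) (τ.prod uL))
    (hhY : Integrable (fun p => h (Function.uncurry Y p)) (τ.prod P))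
    (hhQ : Integrable (fun p => h (Function.uncurry Q p)) (τ.prod uL)) :
    ∫ ω, h (∫ t, Y t ω ∂τ) ∂P ≤ ∫ l, h (∫ t, Q t l ∂τ) ∂uL := by
  have hIZ := jensen_integrable hconv hY hYi hhY
  have hIW := jensen_integrable hconv hQ hQi hhQ
  obtain ⟨g, hgm, hg⟩ := exists_subgrad hconv
  have hc : Continuous h := continuousOn_univ.1 (hconv.continuousOn isOpen_univ)
  set Z : Ω → ℝ := fun ω => ∫ t, Y t ω ∂τ with hZdef
  set W : ℝ → ℝ := fun l => ∫ t, Q t l ∂τ with hWdef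
  have hZm : Measurable Z := hY.stronglyMeasurable.integral_prod_left.measurable
  have hWm : Measurable W := hQ.stronglyMeasurable.integral_prod_left.measurable
  have hZi : Integrable Z P := hYi.integral_prod_right
  have hWi : Integrable W uL := hQi.integral_prod_right
  have hprobZ : IsProbabilityMeasure (P.map Z) :=
    Measure.isProbabilityMeasure_map hZm.aemeasurable
  set U := qf (P.map Z) with hUdef
  have hUm : Measurable U := qf_measurable _
  have hZU : P.map Z = uL.map U := (qf_map _).symm
  have hUmono : MonotoneOn U (Ioo (0:ℝ) 1) := qf_monotoneOn _
  -- equal means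
  have hmean : ∫ ω, Z ω ∂P ≤ ∫ l, W l ∂uL := by
    simpa using upset_le_int hY hQ hmono hlaw hYi hQi (A := univ) (S := univ)
      MeasurableSet.univ MeasurableSet.univ (by simp) (by simp)
  have hmean' : ∫ ω, Z ω ∂P = ∫ l, W l ∂uL := by
    change ∫ ω, (∫ t, Y t ω ∂τ) ∂P = ∫ l, (∫ t, Q t l ∂τ) ∂uL
    rw [← integral_integral_swap hYi, ← integral_integral_swap hQi]
    refine integral_congr_ae (Eventually.of_forall fun t => ?_)
    exact integral_eq_of_law (hY.comp measurable_prodMk_left) (hQ.comp measurable_prodMk_left)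
      (hlaw t) (f := fun x => x) measurable_id
  -- truncation
  let c : ℕ → ℝ → ℝ := fun n x => max (-(n:ℝ)) (min (n:ℝ) x)
  have hcm : ∀ n, Monotone (c n) := fun n a b hab => max_le_max le_rfl (min_le_min le_rfl hab)
  have hcl : ∀ (n : ℕ) (x : ℝ), -(n:ℝ) ≤ c n x := fun n x => le_max_left _ _
  have hcu : ∀ (n : ℕ) (x : ℝ), c n x ≤ n := fun n x => max_le (by linarith [n.cast_nonneg (α := ℝ)])
    (min_le_left _ _)
  have hcc : ∀ n, Continuous (c n) := fun n => by fun_prop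
  have key : ∀ n : ℕ, ∫ ω, (h (c n (Z ω)) + g (c n (Z ω)) * (Z ω - c n (Z ω))) ∂P
      ≤ ∫ l, h (W l) ∂uL := by
    intro n
    let G : ℝ → ℝ := fun x => g (c n x)
    have hGm : Monotone G := hgm.comp (hcm n)
    have hGl : ∀ x, g (-n) ≤ G x := fun x => hgm (hcl n x)
    have hGu : ∀ x, G x ≤ g n := fun x => hgm (hcu n x)
    let B : ℝ → ℝ := fun x => h (c n x) - G x * c n x
    have hBm : Measurable B := ((hc.comp (hcc n)).measurable).sub
      (hGm.measurable.mul (hcc n).measurable)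
    have hGb : ∀ x, ‖G x‖ ≤ |g (-n)| + |g n| := by
      intro x
      rw [Real.norm_eq_abs, abs_le]
      have := hGl x; have := hGu x
      have := neg_abs_le (g (-n)); have := le_abs_self (g n)
      have := abs_nonneg (g (-n)); have := abs_nonneg (g n)
      constructor <;> linarith
    obtain ⟨C, hC⟩ : ∃ C, ∀ y ∈ Icc (-(n:ℝ)) n, ‖h y‖ ≤ C :=
      (isCompact_Icc).exists_bound_of_continuousOn hc.continuousOn
    have hcb : ∀ x, |c n x| ≤ n := fun x => abs_le.2 ⟨hcl n x, hcu n x⟩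
    have hBb : ∀ x, ‖B x‖ ≤ C + (|g (-n)| + |g n|) * n := by
      intro x
      refine (norm_sub_le _ _).trans (add_le_add (hC _ ⟨hcl n x, hcu n x⟩) ?_)
      rw [norm_mul]
      exact mul_le_mul (hGb x) (hcb x) (norm_nonneg _) (by positivity)
    have hBZ : Integrable (fun ω => B (Z ω)) P :=
      Integrable.of_bound (hBm.comp hZm).aestronglyMeasurable _ (Eventually.of_forall fun ω => hBb _)
    have hBU : Integrable (fun l => B (U l)) uL :=
      Integrable.of_bound (hBm.comp hUm).aestronglyMeasurable _ (Eventually.of_forall fun ω => hBb _)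
    have hGZ : Integrable (fun ω => G (Z ω) * Z ω) P :=
      hZi.bdd_mul (hGm.measurable.comp hZm).aestronglyMeasurable
        (Eventually.of_forall fun ω => hGb _)
    have hGU : Integrable (fun l => G (U l) * W l) uL :=
      hWi.bdd_mul (hGm.measurable.comp hUm).aestronglyMeasurable
        (Eventually.of_forall fun ω => hGb _)
    have e1 : ∫ ω, B (Z ω) ∂P = ∫ l, B (U l) ∂uL := integral_eq_of_law hZm hUm hZU hBm
    have e2 : ∫ ω, G (Z ω) * Z ω ∂P ≤ ∫ l, G (U l) * W l ∂uL := by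
      have := mono_prod_le hY hQ hmono hlaw hYi hQi hZm hUm hUmono hZU
        (ψ := fun x => G x - g (-n)) (M := g n - g (-n))
        (fun a b hab => sub_le_sub_right (hGm hab) _) (fun x => sub_nonneg.2 (hGl x))
        (fun x => sub_le_sub_right (hGu x) _)
      change ∫ ω, (G (Z ω) - g (-n)) * Z ω ∂P ≤ ∫ l, (G (U l) - g (-n)) * W l ∂uL at this
      simp_rw [sub_mul] at this
      rw [integral_sub hGZ (hZi.const_mul _), integral_sub hGU (hWi.const_mul _),
        integral_const_mul, integral_const_mul, hmean'] at this
      linarith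
    have e3 : ∫ l, (B (U l) + G (U l) * W l) ∂uL ≤ ∫ l, h (W l) ∂uL := by
      refine integral_mono (hBU.add hGU) hIW fun l => ?_
      have := hg (c n (U l)) (W l)
      simp only [B, G]
      linarith
    have e4 : ∫ ω, (h (c n (Z ω)) + g (c n (Z ω)) * (Z ω - c n (Z ω))) ∂P
        = ∫ ω, (B (Z ω) + G (Z ω) * Z ω) ∂P := by
      congr 1; funext ω; simp only [B, G]; ring
    rw [e4, integral_add hBZ hGZ, e1]
    rw [integral_add hBU hGU] at e3
    linarith
  have hlim : Tendsto (fun n : ℕ => ∫ ω, (h (c n (Z ω)) + g (c n (Z ω)) * (Z ω - c n (Z ω))) ∂P)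
      atTop (nhds (∫ ω, h (Z ω) ∂P)) := by
    refine tendsto_integral_of_dominated_convergence
      (fun ω => |h (Z ω)| + (|h 0| + |g 0| * |Z ω|)) ?_ ?_ ?_ ?_
    · intro n
      have h1 : Measurable fun ω => c n (Z ω) := (hcc n).measurable.comp hZm
      exact ((hc.measurable.comp h1).add
        ((hgm.measurable.comp h1).mul (hZm.sub h1))).aestronglyMeasurable
    · exact hIZ.abs.add ((integrable_const _).add (hZi.abs.const_mul _))
    · intro n
      refine Eventually.of_forall fun ω => ?_
      generalize Z ω = z
      have hup := hg (c n z) z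
      have hn : (0:ℝ) ≤ n := n.cast_nonneg
      have hlow : h 0 + g 0 * z ≤ h (c n z) + g (c n z) * (z - c n z) := by
        have h0 := hg 0 (c n z)
        have hprod : 0 ≤ (g (c n z) - g 0) * (z - c n z) := by
          rcases le_total z n with hz | hz
          · rcases le_total (-(n:ℝ)) z with hz' | hz'
            · have : c n z = z := by simp [c, hz, hz']
              simp [this]
            · have : c n z = -n := by simp [c, hz, hz']
              rw [this]
              exact mul_nonneg_of_nonpos_of_nonpos (sub_nonpos.2 (hgm (by linarith)))
                (by linarith)
          · have : c n z = n := by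
              simp only [c]; rw [min_eq_left hz, max_eq_right (by linarith)]
            rw [this]
            exact mul_nonneg (sub_nonneg.2 (hgm hn)) (by linarith)
        nlinarith
      have a1 := neg_abs_le (h 0)
      have a2 := neg_abs_le (g 0 * z)
      rw [abs_mul] at a2
      have a3 := le_abs_self (h z)
      have a4 := abs_nonneg (h z)
      have a5 : 0 ≤ |g 0| * |z| := by positivity
      have a6 := abs_nonneg (h 0)
      rw [Real.norm_eq_abs, abs_le]
      constructor <;> linarith
    · refine Eventually.of_forall fun ω => ?_
      refine tendsto_const_nhds.congr' ?_
      obtain ⟨N, hN⟩ := exists_nat_ge |Z ω|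
      filter_upwards [eventually_ge_atTop N] with n hn
      have hn' : (N:ℝ) ≤ n := by exact_mod_cast hn
      have hz := abs_le.1 (hN.trans hn')
      have : c n (Z ω) = Z ω := by simp [c, hz.1, hz.2]
      rw [this]; simp
  exact le_of_tendsto' hlim key

end core

/-- Theorem 3.2.1 of the paper (extension to merely convex `h`): if `h` is convex,
assumptions 2–6 hold, and additionally the second moments of `μ_t` exist and are
integrable in `t`, then `X^opt` is optimal: every `Y ∈ Π` satisfies
`E[h(∫₀¹ Y_t dt)] ≤ E[h(∫₀¹ X^opt_t dt)] = ∫₀¹ h(∫₀¹ x_λ(t) dt) dλ`. -/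
theorem statement6
    (μ : ℝ → Measure ℝ) (h : ℝ → ℝ)
    (hprob : ∀ t ∈ Icc (0:ℝ) 1, IsProbabilityMeasure (μ t))
    -- h convex (not necessarily strictly convex or smooth)
    (hconv : ConvexOn ℝ Set.univ h)
    -- assumption 2: absolute continuity
    (hac : ∀ t ∈ Icc (0:ℝ) 1, μ t ≪ (volume : Measure ℝ))
    -- assumption 3: the support of each μ_t is an interval
    (hsupp : ∀ t ∈ Icc (0:ℝ) 1, (mSupport (μ t)).OrdConnected)
    -- assumption 4: weak continuity of t ↦ μ_t
    (hweak : ∀ f : BoundedContinuousFunction ℝ ℝ,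
      ContinuousOn (fun t => ∫ x, f x ∂(μ t)) (Icc (0:ℝ) 1))
    -- assumption 5: first moments and h-moments exist and are integrable in t
    (hmom1 : ∀ t ∈ Icc (0:ℝ) 1, Integrable (fun x : ℝ => x) (μ t))
    (hmom1' : IntegrableOn (fun t => ∫ x, x ∂(μ t)) (Icc (0:ℝ) 1) volume)
    (hmomh : ∀ t ∈ Icc (0:ℝ) 1, Integrable h (μ t))
    (hmomh' : IntegrableOn (fun t => ∫ x, h x ∂(μ t)) (Icc (0:ℝ) 1) volume)
    -- additional assumption: second moments exist and are integrable in t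
    (hmom2 : ∀ t ∈ Icc (0:ℝ) 1, Integrable (fun x : ℝ => x ^ 2) (μ t))
    (hmom2' : IntegrableOn (fun t => ∫ x, x ^ 2 ∂(μ t)) (Icc (0:ℝ) 1) volume)
    -- assumption 6: uniform convergence of Riemann sums of λ ↦ x_λ(·) on compacts of (0,1)
    (hriemann : ∀ K : Set ℝ, IsCompact K → K ⊆ Ioo (0:ℝ) 1 →
      TendstoUniformlyOn
        (fun (N : ℕ) (l : ℝ) =>
          (N : ℝ)⁻¹ * ∑ i ∈ Finset.Icc 1 N, mQuantile (μ ((i : ℝ) / (N : ℝ))) l)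
        (fun l => ∫ t in (0:ℝ)..1, mQuantile (μ t) l) Filter.atTop K)
    {Ω : Type*} [MeasurableSpace Ω] (P : Measure Ω) [IsProbabilityMeasure P]
    (Y : ℝ → Ω → ℝ)
    (hYcont : ∀ ω, ContinuousOn (fun t => Y t ω) (Icc (0:ℝ) 1))
    (hYmeas : ∀ t ∈ Icc (0:ℝ) 1, Measurable (Y t))
    (hYlaw : ∀ t ∈ Icc (0:ℝ) 1, Measure.map (Y t) P = μ t)
    :
    ∫ ω, h (∫ t in (0:ℝ)..1, Y t ω) ∂P ≤
      ∫ l in Ioo (0:ℝ) 1, h (∫ t in (0:ℝ)..1, mQuantile (μ t) l) := by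
  have h01 : (0:ℝ) ≤ 1 := zero_le_one
  let p : ℝ → ℝ := fun t => (projIcc (0:ℝ) 1 h01 t : ℝ)
  have hp : ∀ t, p t ∈ Icc (0:ℝ) 1 := fun t => (projIcc (0:ℝ) 1 h01 t).2
  have hpeq : ∀ t ∈ Icc (0:ℝ) 1, p t = t := fun t ht => by
    simp only [p, projIcc_of_mem h01 ht]
  let ν : ℝ → Measure ℝ := fun t => μ (p t)
  let Y' : ℝ → Ω → ℝ := fun t => Y (p t)
  let Q : ℝ → ℝ → ℝ := fun t l => qf (ν t) l
  let τ : Measure ℝ := volume.restrict (Ioc (0:ℝ) 1)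
  have hτ : IsProbabilityMeasure τ := ⟨by simp [τ]⟩
  have hνp : ∀ t, IsProbabilityMeasure (ν t) := fun t => hprob _ (hp t)
  have hY'm : ∀ t, Measurable (Y' t) := fun t => hYmeas _ (hp t)
  have hY'l : ∀ t, P.map (Y' t) = ν t := fun t => hYlaw _ (hp t)
  have hY : Measurable (Function.uncurry Y') := by
    refine measurable_uncurry_of_continuous_of_measurable (fun ω => ?_) hY'm
    exact (hYcont ω).comp_continuous (continuous_subtype_val.comp continuous_projIcc) hp
  have hQ : Measurable (Function.uncurry Q) := by
    refine qf_uncurry_measurable ν fun x => ?_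
    have h1 : MeasurableSet {z : ℝ × Ω | Function.uncurry Y' z ≤ x} :=
      measurableSet_le hY measurable_const
    have h2 := (measurable_measure_prodMk_left (ν := P) h1).ennreal_toReal
    convert h2 using 2 with t
    simp only [mCdf]
    rw [← hY'l t, Measure.map_apply (hY'm t) measurableSet_Iic]
    rfl
  have hlaw : ∀ t, P.map (Y' t) = uL.map (Q t) := fun t => by
    rw [hY'l t]; exact (qf_map (ν t)).symm
  have hQm : ∀ t, Measurable (Q t) := fun t => qf_measurable (ν t)
  have hc : Continuous h := continuousOn_univ.1 (hconv.continuousOn isOpen_univ)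
  -- transfer between the two product spaces
  have hjoint : (τ.prod P).map (Function.uncurry Y') = (τ.prod uL).map (Function.uncurry Q) := by
    ext s hs
    rw [Measure.map_apply hY hs, Measure.map_apply hQ hs, Measure.prod_apply (hY hs),
      Measure.prod_apply (hQ hs)]
    refine lintegral_congr fun t => ?_
    have := congrArg (fun m => m s) (hlaw t)
    simp only [Measure.map_apply (hY'm t) hs, Measure.map_apply (hQm t) hs] at this
    exact this
  have hτae : ∀ᵐ t ∂τ, t ∈ Icc (0:ℝ) 1 :=
    (ae_restrict_mem measurableSet_Ioc).mono fun t ht => Ioc_subset_Icc_self ht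
  have hmoment : ∀ f : ℝ → ℝ, Measurable f → (∀ t ∈ Icc (0:ℝ) 1, Integrable f (μ t)) →
      ∀ b : ℝ → ℝ, Integrable b τ → (∀ t ∈ Icc (0:ℝ) 1, ∫ x, |f x| ∂(μ t) ≤ b t) →
      Integrable (fun z => f (Function.uncurry Y' z)) (τ.prod P) := by
    intro f hf hfi b hb hfb
    have hm : Measurable (fun z => f (Function.uncurry Y' z)) := hf.comp hY
    refine (integrable_prod_iff hm.aestronglyMeasurable).2 ⟨?_, ?_⟩
    · refine Eventually.of_forall fun t => ?_
      have h1 := hfi _ (hp t)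
      rw [← hYlaw _ (hp t)] at h1
      exact (integrable_map_measure hf.aestronglyMeasurable (hY'm t).aemeasurable).1 h1
    · refine hb.mono' hm.norm.stronglyMeasurable.integral_prod_right'.aestronglyMeasurable ?_
      filter_upwards [hτae] with t ht
      have h2 : ∫ ω, ‖f (Function.uncurry Y' (t, ω))‖ ∂P = ∫ x, |f x| ∂(μ t) := by
        rw [← hYlaw t ht, integral_map (hYmeas t ht).aemeasurable
          (hf.abs).aestronglyMeasurable]
        simp only [Function.uncurry, Y', hpeq t ht, Real.norm_eq_abs]
      rw [h2, Real.norm_eq_abs, abs_of_nonneg (integral_nonneg fun x => abs_nonneg _)]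
      exact hfb t ht
  have hm2τ : Integrable (fun t => ∫ x, x ^ 2 ∂(μ t)) τ := hmom2'.mono_set Ioc_subset_Icc_self
  have hmhτ : Integrable (fun t => ∫ x, h x ∂(μ t)) τ := hmomh'.mono_set Ioc_subset_Icc_self
  have hYi : Integrable (Function.uncurry Y') (τ.prod P) := by
    refine hmoment (fun x => x) measurable_id hmom1 (fun t => 1 + ∫ x, x ^ 2 ∂(μ t))
      ((integrable_const _).add hm2τ) fun t ht => ?_
    have := hprob t ht
    have e : ∫ x, (1 + x ^ 2) ∂(μ t) = 1 + ∫ x, x ^ 2 ∂(μ t) := by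
      rw [integral_add (integrable_const _) (hmom2 t ht)]; simp
    rw [← e]
    refine integral_mono (hmom1 t ht).abs ((integrable_const _).add (hmom2 t ht)) fun x => ?_
    simp only
    rcases abs_cases x with ⟨h1, _⟩ | ⟨h1, _⟩ <;> rw [h1] <;> nlinarith [sq_nonneg (x-1), sq_nonneg (x+1)]
  have hhY : Integrable (fun z => h (Function.uncurry Y' z)) (τ.prod P) := by
    obtain ⟨g, -, hg⟩ := exists_subgrad hconv
    obtain ⟨C, hC⟩ : ∃ C : ℝ, C = 2 * (|h 0| + |g 0|) := ⟨_, rfl⟩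
    refine hmoment h hc.measurable hmomh
      (fun t => ∫ x, h x ∂(μ t) + (C + C * ∫ x, x ^ 2 ∂(μ t)))
      (hmhτ.add ((integrable_const _).add (hm2τ.const_mul _))) fun t ht => ?_
    have := hprob t ht
    have i1 : Integrable (fun x : ℝ => C + C * x ^ 2) (μ t) :=
      (integrable_const _).add ((hmom2 t ht).const_mul _)
    have e : ∫ x, (h x + (C + C * x ^ 2)) ∂(μ t)
        = ∫ x, h x ∂(μ t) + (C + C * ∫ x, x ^ 2 ∂(μ t)) := by
      rw [integral_add (hmomh t ht) i1,
        integral_add (integrable_const _) ((hmom2 t ht).const_mul _), integral_const_mul]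
      simp
    rw [← e]
    refine integral_mono (hmomh t ht).abs ((hmomh t ht).add i1) fun x => ?_
    have b1 := hg 0 x
    have b2 := neg_abs_le (h 0)
    have b3 := neg_abs_le (g 0 * x)
    rw [abs_mul] at b3
    have b4 : |x| ≤ 1 + x ^ 2 := by
      rcases abs_cases x with ⟨h1, _⟩ | ⟨h1, _⟩ <;> rw [h1] <;>
        nlinarith [sq_nonneg (x-1), sq_nonneg (x+1)]
    have b5 : |g 0| * |x| ≤ |g 0| * (1 + x ^ 2) := mul_le_mul_of_nonneg_left b4 (abs_nonneg _)
    have b6 : 0 ≤ |h 0| * x ^ 2 := by positivity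
    have b7 : 0 ≤ |g 0| * x ^ 2 := by positivity
    have b8 := abs_nonneg (h 0)
    have b9 := abs_nonneg (g 0)
    rw [sub_zero] at b1
    simp only [hC]
    rw [abs_le]
    constructor <;> nlinarith
  have hQi : Integrable (Function.uncurry Q) (τ.prod uL) :=
    integrable_of_law hY hQ hjoint (f := fun x => x) measurable_id hYi
  have hhQ : Integrable (fun z => h (Function.uncurry Q z)) (τ.prod uL) :=
    integrable_of_law hY hQ hjoint hc.measurable hhY
  have hmain := core hconv hY hQ (fun t => qf_monotoneOn (ν t)) hlaw hYi hQi hhY hhQ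
  have eL : ∀ ω, ∫ t in (0:ℝ)..1, Y t ω = ∫ t, Y' t ω ∂τ := by
    intro ω
    rw [intervalIntegral.integral_of_le h01]
    refine setIntegral_congr_fun measurableSet_Ioc fun t ht => ?_
    simp only [Y', hpeq t (Ioc_subset_Icc_self ht)]
  have eR : ∫ l in Ioo (0:ℝ) 1, h (∫ t in (0:ℝ)..1, mQuantile (μ t) l)
      = ∫ l, h (∫ t, Q t l ∂τ) ∂uL := by
    refine setIntegral_congr_fun measurableSet_Ioo fun l hl => ?_
    rw [intervalIntegral.integral_of_le h01]
    congr 1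
    refine setIntegral_congr_fun measurableSet_Ioc fun t ht => ?_
    simp only [Q, qf, ν, hpeq t (Ioc_subset_Icc_self ht), if_pos hl]
  simp_rw [eL]
  rw [eR]
  exact hmain
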